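/- arXiv:2401.12837 — 5 statements merged into one kernel-verified Lean document; each statement's English description precedes it below -/
import Mathlib

section
/- Let q₀(t) = 3·(6 − 7·cos t − 10·cos² t)/(10·(2 + cos t)²) for t ∈ [0,2π], and write (q₀)₊(t) = max{q₀(t),0}, (q₀)₋(t) = −min{q₀(t),0}. Then ∫₀^{2π} (q₀)₋(s) ds > 0, ∫₀^{2π} (q₀)₊(s) ds > 0, ∫₀^{2π} (q₀)₋(s) ds < 2/π, and ∫₀^{2π} (q₀)₋(s) ds < (1 − (π/2)·∫₀^{2π} (q₀)₋(s) ds)·∫₀^{2π} (q₀)₊(s) ds. -/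
open MeasureTheory Set

/-- The Taylor polynomial of degree five bounds `arctan` from above on the nonnegative reals. -/
lemma arctan_le_taylor_five {x : ℝ} (hx : 0 ≤ x) :
    Real.arctan x ≤ x - x ^ 3 / 3 + x ^ 5 / 5 := by
  have hderiv (y : ℝ) : HasDerivAt (fun z : ℝ => z - z ^ 3 / 3 + z ^ 5 / 5 - Real.arctan z)
      (y ^ 6 / (1 + y ^ 2)) y := by
    have h := (((hasDerivAt_id y).sub (((hasDerivAt_id y).pow 3).div_const 3)).add
      (((hasDerivAt_id y).pow 5).div_const 5)).sub (Real.hasDerivAt_arctan y)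
    refine h.congr_deriv ?_
    have : 1 + y ^ 2 ≠ 0 := by positivity
    simp only [id]
    field_simp
    ring
  have hmono := monotone_of_hasDerivAt_nonneg hderiv (fun y => by
    show 0 ≤ y ^ 6 / (1 + y ^ 2)
    positivity)
  have h := hmono hx
  norm_num at h
  linarith

lemma two_add_cos_pos (t : ℝ) : 0 < 2 + Real.cos t := by
  linarith [Real.neg_one_le_cos t]

/-- The linearization coefficient of the Liebau model. -/
noncomputable def liebauCoeff (t : ℝ) : ℝ :=
  3 * (6 - 7 * Real.cos t - 10 * (Real.cos t) ^ 2) / (10 * (2 + Real.cos t) ^ 2)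

/-- A primitive of `liebauCoeff`, smooth on the whole real line. -/
noncomputable def liebauPrimitive (t : ℝ) : ℝ :=
  -3 * t + 59 / 30 * √3 * (t - 2 * Real.arctan (Real.sin t / (2 + √3 + Real.cos t)))
    + 2 * (Real.sin t / (2 + Real.cos t))

lemma continuous_liebauCoeff : Continuous liebauCoeff := by
  unfold liebauCoeff
  refine Continuous.div (by fun_prop) (by fun_prop) fun t => ?_
  have := two_add_cos_pos t
  positivity

lemma hasDerivAt_liebauPrimitive (t : ℝ) :
    HasDerivAt liebauPrimitive (liebauCoeff t) t := by
  have h2 := two_add_cos_pos t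
  have hr : 0 < √3 := by positivity
  have hr2 : √3 ^ 2 = 3 := Real.sq_sqrt (by norm_num)
  have hk : 0 < 2 + √3 + Real.cos t := by linarith
  have hsc := Real.sin_sq_add_cos_sq t
  have hquot (k : ℝ) (h : k + Real.cos t ≠ 0) :
      HasDerivAt (fun s => Real.sin s / (k + Real.cos s))
        ((k * Real.cos t + 1) / (k + Real.cos t) ^ 2) t := by
    refine ((Real.hasDerivAt_sin t).div ((Real.hasDerivAt_cos t).const_add k) h).congr_deriv ?_
    rw [div_left_inj' (pow_ne_zero 2 h)]
    linear_combination hsc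
  have harctan : HasDerivAt
      (fun s => s - 2 * Real.arctan (Real.sin s / (2 + √3 + Real.cos s)))
      (√3 / (2 + Real.cos t)) t := by
    refine ((hasDerivAt_id t).sub ((hquot _ hk.ne').arctan.const_mul 2)).congr_deriv ?_
    have hden : (2 + √3 + Real.cos t) ^ 2 + Real.sin t ^ 2
        = 2 * (2 + √3) * (2 + Real.cos t) := by
      linear_combination hsc + hr2
    have hfrac : 1 / (1 + (Real.sin t / (2 + √3 + Real.cos t)) ^ 2)
        = (2 + √3 + Real.cos t) ^ 2 / (2 * (2 + √3) * (2 + Real.cos t)) := by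
      rw [← hden]
      field_simp
    rw [hfrac]
    field_simp
    linear_combination -hr2
  have h := (((hasDerivAt_id t).const_mul (-3)).add (harctan.const_mul (59 / 30 * √3))).add
    ((hquot 2 h2.ne').const_mul 2)
  refine h.congr_deriv ?_
  unfold liebauCoeff
  field_simp
  rw [hr2]
  ring

lemma integral_liebauCoeff (a b : ℝ) :
    ∫ s in a..b, liebauCoeff s = liebauPrimitive b - liebauPrimitive a :=
  intervalIntegral.integral_eq_sub_of_hasDerivAt
    (fun t _ => hasDerivAt_liebauPrimitive t) (continuous_liebauCoeff.intervalIntegrable _ _)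

lemma liebauCoeff_nonpos {t : ℝ} (h : 1 / 2 ≤ Real.cos t) : liebauCoeff t ≤ 0 := by
  have := two_add_cos_pos t
  exact div_nonpos_of_nonpos_of_nonneg (by nlinarith) (by positivity)

lemma liebauCoeff_nonneg {t : ℝ} (h : Real.cos t ≤ 1 / 2) : 0 ≤ liebauCoeff t := by
  have := two_add_cos_pos t
  have := Real.neg_one_le_cos t
  exact div_nonneg (by nlinarith) (by positivity)

lemma half_le_cos {t : ℝ} (h0 : 0 ≤ t) (h : t ≤ Real.pi / 3) : 1 / 2 ≤ Real.cos t := by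
  rw [← Real.cos_pi_div_three]
  exact Real.cos_le_cos_of_nonneg_of_le_pi h0 (by linarith [Real.pi_pos]) h

lemma cos_le_half {t : ℝ} (h0 : Real.pi / 3 ≤ t) (h : t ≤ 5 * Real.pi / 3) :
    Real.cos t ≤ 1 / 2 := by
  have hpi := Real.pi_pos
  rw [← Real.cos_pi_div_three]
  rcases le_total t Real.pi with ht | ht
  · exact Real.cos_le_cos_of_nonneg_of_le_pi (by linarith) ht h0
  · rw [← Real.cos_two_pi_sub t]
    exact Real.cos_le_cos_of_nonneg_of_le_pi (by linarith) (by linarith) (by linarith)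

lemma liebauPrimitive_zero : liebauPrimitive 0 = 0 := by
  simp [liebauPrimitive]

lemma liebauPrimitive_two_pi :
    liebauPrimitive (2 * Real.pi) = -6 * Real.pi + 59 / 15 * √3 * Real.pi := by
  simp only [liebauPrimitive, Real.sin_two_pi, Real.cos_two_pi, zero_div, Real.arctan_zero]
  ring

lemma liebauPrimitive_pi_div_three :
    liebauPrimitive (Real.pi / 3) = -Real.pi
      + 59 / 30 * √3 * (Real.pi / 3 - 2 * Real.arctan (√3 / (5 + 2 * √3))) + 2 * √3 / 5 := by
  have h : √3 / 2 / (2 + √3 + 1 / 2) = √3 / (5 + 2 * √3) := by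
    field_simp
    ring
  rw [liebauPrimitive, Real.sin_pi_div_three, Real.cos_pi_div_three, h]
  ring

lemma liebauPrimitive_two_pi_sub (t : ℝ) :
    liebauPrimitive (2 * Real.pi - t) = liebauPrimitive (2 * Real.pi) - liebauPrimitive t := by
  rw [liebauPrimitive_two_pi]
  simp only [liebauPrimitive, Real.sin_two_pi_sub, Real.cos_two_pi_sub, neg_div,
    Real.arctan_neg]
  ring

lemma integral_neg_min_liebauCoeff :
    ∫ s in (0:ℝ)..(2 * Real.pi), -min (liebauCoeff s) 0
      = -2 * liebauPrimitive (Real.pi / 3) := by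
  have hpi := Real.pi_pos
  have hint (a b : ℝ) :
      IntervalIntegrable (fun s => -min (liebauCoeff s) 0) volume a b :=
    (continuous_liebauCoeff.min continuous_const).neg.intervalIntegrable _ _
  have hleft : ∫ s in (0:ℝ)..(Real.pi / 3), -min (liebauCoeff s) 0
      = -liebauPrimitive (Real.pi / 3) := by
    rw [intervalIntegral.integral_congr (g := fun s => -liebauCoeff s),
      intervalIntegral.integral_neg, integral_liebauCoeff, liebauPrimitive_zero, sub_zero]
    intro s hs
    rw [uIcc_of_le (by positivity)] at hs
    simp only [min_eq_left (liebauCoeff_nonpos (half_le_cos hs.1 hs.2))]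
  have hmid : ∫ s in (Real.pi / 3)..(5 * Real.pi / 3), -min (liebauCoeff s) 0 = 0 := by
    rw [intervalIntegral.integral_congr (g := fun _ => (0:ℝ)), intervalIntegral.integral_zero]
    intro s hs
    rw [uIcc_of_le (by linarith)] at hs
    simp only [min_eq_right (liebauCoeff_nonneg (cos_le_half hs.1 hs.2)), neg_zero]
  have hright : ∫ s in (5 * Real.pi / 3)..(2 * Real.pi), -min (liebauCoeff s) 0
      = -liebauPrimitive (Real.pi / 3) := by
    have h : 5 * Real.pi / 3 = 2 * Real.pi - Real.pi / 3 := by ring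
    rw [intervalIntegral.integral_congr (g := fun s => -liebauCoeff s),
      intervalIntegral.integral_neg, integral_liebauCoeff, h, liebauPrimitive_two_pi_sub]
    · ring
    · intro s hs
      rw [uIcc_of_le (by linarith)] at hs
      have hcos : 1 / 2 ≤ Real.cos s := by
        rw [← Real.cos_two_pi_sub]
        exact half_le_cos (by linarith [hs.2]) (by linarith [hs.1])
      simp only [min_eq_left (liebauCoeff_nonpos hcos)]
  rw [← intervalIntegral.integral_add_adjacent_intervals (hint 0 (5 * Real.pi / 3)) (hint _ _),
    ← intervalIntegral.integral_add_adjacent_intervals (hint 0 (Real.pi / 3)) (hint _ _),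
    hleft, hmid, hright]
  ring

lemma integral_max_liebauCoeff :
    ∫ s in (0:ℝ)..(2 * Real.pi), max (liebauCoeff s) 0
      = liebauPrimitive (2 * Real.pi)
        + ∫ s in (0:ℝ)..(2 * Real.pi), -min (liebauCoeff s) 0 := by
  have htotal := integral_liebauCoeff 0 (2 * Real.pi)
  rw [liebauPrimitive_zero, sub_zero] at htotal
  have hcont : Continuous fun s => -min (liebauCoeff s) 0 :=
    (continuous_liebauCoeff.min continuous_const).neg
  rw [← htotal, ← intervalIntegral.integral_add
    (continuous_liebauCoeff.intervalIntegrable _ _) (hcont.intervalIntegrable _ _)]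
  congr 1
  ext s
  linarith [max_add_min (liebauCoeff s) 0]

lemma integral_neg_min_liebauCoeff_pos :
    0 < ∫ s in (0:ℝ)..(2 * Real.pi), -min (liebauCoeff s) 0 := by
  refine intervalIntegral.integral_pos (by positivity)
    (continuous_liebauCoeff.min continuous_const).neg.continuousOn
    (fun s _ => neg_nonneg.2 (min_le_right _ _)) ⟨0, ⟨le_rfl, by positivity⟩, ?_⟩
  norm_num [liebauCoeff]

lemma sqrt_three_bounds : 1.73205 < √3 ∧ √3 < 1.73206 :=
  ⟨Real.lt_sqrt_of_sq_lt (by norm_num), (Real.sqrt_lt' (by norm_num)).2 (by norm_num)⟩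

lemma integral_neg_min_liebauCoeff_lt :
    ∫ s in (0:ℝ)..(2 * Real.pi), -min (liebauCoeff s) 0 < 0.52 := by
  obtain ⟨hr1, hr2⟩ := sqrt_three_bounds
  have hp1 := Real.pi_gt_d4
  have hp2 := Real.pi_lt_d4
  have harctan : Real.arctan (√3 / (5 + 2 * √3)) ≤ 0.202 := by
    have hle : √3 / (5 + 2 * √3) ≤ 0.2047 := by
      rw [div_le_iff₀ (by positivity)]
      linarith
    refine (Real.arctan_le_arctan_iff.2 hle).trans
      ((arctan_le_taylor_five (by norm_num)).trans (by norm_num))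
  rw [integral_neg_min_liebauCoeff, liebauPrimitive_pi_div_three]
  have h1 : √3 * Real.arctan (√3 / (5 + 2 * √3)) ≤ √3 * 0.202 := by gcongr
  have h2 : 1.73205 * Real.pi ≤ √3 * Real.pi := by gcongr
  linarith

lemma liebauPrimitive_two_pi_gt : 2.54 < liebauPrimitive (2 * Real.pi) := by
  rw [liebauPrimitive_two_pi]
  have h : 1.73205 * Real.pi ≤ √3 * Real.pi := by
    gcongr
    exact sqrt_three_bounds.1.le
  linarith [Real.pi_gt_d4]

/-- The integral inequalities for the coefficient
`q₀ t = 3(6 − 7cos t − 10cos²t)/(10(2+cos t)²)` arising from the linearization of the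
Liebau pumping model: they verify the hypotheses of the periodic nondegeneracy
criterion with `T = 2π`. -/
theorem stmt1 :
    let q₀ : ℝ → ℝ :=
      fun t => 3 * (6 - 7 * Real.cos t - 10 * (Real.cos t)^2) / (10 * (2 + Real.cos t)^2)
    0 < (∫ s in (0:ℝ)..(2*Real.pi), -min (q₀ s) 0) ∧
    0 < (∫ s in (0:ℝ)..(2*Real.pi), max (q₀ s) 0) ∧
    (∫ s in (0:ℝ)..(2*Real.pi), -min (q₀ s) 0) < 2 / Real.pi ∧
    (∫ s in (0:ℝ)..(2*Real.pi), -min (q₀ s) 0)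
      < (1 - (Real.pi / 2) * ∫ s in (0:ℝ)..(2*Real.pi), -min (q₀ s) 0)
        * ∫ s in (0:ℝ)..(2*Real.pi), max (q₀ s) 0 := by
  change 0 < (∫ s in (0:ℝ)..(2*Real.pi), -min (liebauCoeff s) 0) ∧
    0 < (∫ s in (0:ℝ)..(2*Real.pi), max (liebauCoeff s) 0) ∧
    (∫ s in (0:ℝ)..(2*Real.pi), -min (liebauCoeff s) 0) < 2 / Real.pi ∧
    (∫ s in (0:ℝ)..(2*Real.pi), -min (liebauCoeff s) 0)
      < (1 - (Real.pi / 2) * ∫ s in (0:ℝ)..(2*Real.pi), -min (liebauCoeff s) 0)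
        * ∫ s in (0:ℝ)..(2*Real.pi), max (liebauCoeff s) 0
  have hpos := integral_neg_min_liebauCoeff_pos
  have hlt := integral_neg_min_liebauCoeff_lt
  have htotal := liebauPrimitive_two_pi_gt
  rw [integral_max_liebauCoeff]
  generalize ∫ s in (0:ℝ)..(2 * Real.pi), -min (liebauCoeff s) 0 = m at *
  generalize liebauPrimitive (2 * Real.pi) = T at *
  have hpi := Real.pi_lt_d4
  refine ⟨hpos, by linarith, ?_, ?_⟩
  · rw [lt_div_iff₀ Real.pi_pos]
    nlinarith
  · have hfactor : 1 - 1.5708 * m ≤ 1 - Real.pi / 2 * m := by nlinarith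
    calc m < (1 - 1.5708 * m) * (2.54 + m) := by nlinarith
      _ ≤ (1 - Real.pi / 2 * m) * (T + m) := by
        gcongr
        nlinarith
end

section
/- Let q₀(t) = 3·(6 − 7·cos t − 10·cos² t)/(10·(2 + cos t)²). Then every twice differentiable function z : [0,2π] → ℝ satisfying z''(t) = q₀(t)·z(t) for all t ∈ [0,2π], z(0) = z(2π) and z'(0) = z'(2π) is identically zero on [0,2π]. -/
open MeasureTheory Set

lemma liebau_quartic_pos {c : ℝ} (h₁ : -1 ≤ c) (h₂ : c ≤ 1) :
    0 < 100 - 58 * c - 66 * c ^ 2 + 59 * c ^ 3 + 10 * c ^ 4 := by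
  rcases le_total 0 c with h | h
  · nlinarith [mul_nonneg h (sq_nonneg (1 - c)), sq_nonneg (c ^ 2), sq_nonneg (c - 9 / 8)]
  · nlinarith [mul_nonneg (neg_nonneg.2 h) (neg_le_iff_add_nonneg.1 h₁),
      mul_nonneg (sq_nonneg c) (neg_le_iff_add_nonneg.1 h₁), sq_nonneg (c ^ 2)]

/-- The logarithmic derivative of `10 + 4 cos t + cos² t`, a strict periodic subsolution of the
Riccati equation `w' + w² = q₀`. -/
noncomputable def liebauRiccati (t : ℝ) : ℝ :=
  -(Real.sin t * (4 + 2 * Real.cos t)) / (10 + 4 * Real.cos t + Real.cos t ^ 2)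

lemma hasDerivAt_liebauRiccati (t : ℝ) :
    HasDerivAt liebauRiccati
      ((2 - 4 * Real.cos t - 4 * Real.cos t ^ 2) / (10 + 4 * Real.cos t + Real.cos t ^ 2)
        - liebauRiccati t ^ 2) t := by
  have hφ : 10 + 4 * Real.cos t + Real.cos t ^ 2 ≠ 0 := by nlinarith [sq_nonneg (Real.cos t + 2)]
  have hc := Real.hasDerivAt_cos t
  have hs := Real.hasDerivAt_sin t
  refine ((hs.mul ((hc.const_mul 2).const_add 4)).neg.div
    (((hc.const_mul 4).const_add 10).add (hc.pow 2)) hφ).congr_deriv ?_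
  simp only [liebauRiccati, Pi.add_apply, Pi.mul_apply, Pi.neg_apply, Pi.pow_apply]
  field_simp
  congr 1
  norm_num
  linear_combination (2 * (10 + 4 * Real.cos t + Real.cos t ^ 2)) * Real.sin_sq_add_cos_sq t

lemma liebauRiccati_lt (t : ℝ) :
    (2 - 4 * Real.cos t - 4 * Real.cos t ^ 2) / (10 + 4 * Real.cos t + Real.cos t ^ 2)
      < 3 * (6 - 7 * Real.cos t - 10 * Real.cos t ^ 2) / (10 * (2 + Real.cos t) ^ 2) := by
  have h₁ := Real.neg_one_le_cos t
  have hφ : 0 < 10 + 4 * Real.cos t + Real.cos t ^ 2 := by nlinarith [sq_nonneg (Real.cos t + 2)]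
  have h₂ : 0 < 2 + Real.cos t := by linarith
  rw [div_lt_div_iff₀ hφ (by positivity)]
  linarith [liebau_quartic_pos h₁ (Real.cos_le_one t)]

/-- The linearized Liebau periodic problem `z'' = q₀ t * z`, `z 0 = z (2π)`,
`z' 0 = z' (2π)` with `q₀ t = 3(6 − 7cos t − 10cos²t)/(10(2+cos t)²)` possesses only
the trivial solution. -/
theorem stmt2
    (q₀ : ℝ → ℝ)
    (hq₀ : ∀ t, q₀ t = 3 * (6 - 7 * Real.cos t - 10 * (Real.cos t)^2)
      / (10 * (2 + Real.cos t)^2))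
    (z z' z'' : ℝ → ℝ)
    (hz : ∀ t ∈ Set.Icc (0:ℝ) (2*Real.pi),
      HasDerivWithinAt z (z' t) (Set.Icc 0 (2*Real.pi)) t)
    (hz' : ∀ t ∈ Set.Icc (0:ℝ) (2*Real.pi),
      HasDerivWithinAt z' (z'' t) (Set.Icc 0 (2*Real.pi)) t)
    (heq : ∀ t ∈ Set.Icc (0:ℝ) (2*Real.pi), z'' t = q₀ t * z t)
    (hper : z 0 = z (2*Real.pi)) (hper' : z' 0 = z' (2*Real.pi)) :
    ∀ t ∈ Set.Icc (0:ℝ) (2*Real.pi), z t = 0 := by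
  have hpi : (0 : ℝ) < 2 * Real.pi := by positivity
  set I := Set.Icc (0 : ℝ) (2 * Real.pi) with hI
  set F : ℝ → ℝ := fun t => z t * z' t - liebauRiccati t * z t ^ 2 with hF
  let r : ℝ → ℝ := fun t => q₀ t
    - (2 - 4 * Real.cos t - 4 * Real.cos t ^ 2) / (10 + 4 * Real.cos t + Real.cos t ^ 2)
  have hr : ∀ t, 0 < r t := fun t => by
    simp only [r, hq₀]
    linarith [liebauRiccati_lt t]
  let F' : ℝ → ℝ := fun t => (z' t - liebauRiccati t * z t) ^ 2 + r t * z t ^ 2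
  have hF' : ∀ t ∈ I, HasDerivWithinAt F (F' t) I t := fun t ht => by
    refine (((hz t ht).mul (hz' t ht)).sub
      ((hasDerivAt_liebauRiccati t).hasDerivWithinAt.mul ((hz t ht).pow 2))).congr_deriv ?_
    simp only [F', r, heq t ht, Pi.pow_apply]
    ring
  have hmono : MonotoneOn F I :=
    monotoneOn_of_hasDerivWithinAt_nonneg (convex_Icc _ _)
      (fun t ht => (hF' t ht).continuousWithinAt)
      (fun t ht => (hF' t (interior_subset ht)).mono interior_subset)
      (fun t _ => add_nonneg (sq_nonneg _) (mul_nonneg (hr t).le (sq_nonneg _)))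
  have hends : F (2 * Real.pi) = F 0 := by
    simp [hF, liebauRiccati, hper, hper']
  have hconst : ∀ t ∈ I, F t = F 0 := fun t ht =>
    le_antisymm (hends ▸ hmono ht (Set.right_mem_Icc.2 hpi.le) ht.2)
      (hmono (Set.left_mem_Icc.2 hpi.le) ht ht.1)
  intro t ht
  have hzero : F' t = 0 := (uniqueDiffOn_Icc hpi t ht).eq_deriv _ (hF' t ht)
    ((hasDerivWithinAt_const t I (F 0)).congr hconst (hconst t ht))
  have hsq : r t * z t ^ 2 ≤ 0 := by
    have := sq_nonneg (z' t - liebauRiccati t * z t)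
    simp only [F'] at hzero
    linarith
  have hz2 : z t ^ 2 ≤ 0 := nonpos_of_mul_nonpos_right hsq (hr t)
  exact pow_eq_zero_iff two_ne_zero |>.1 (le_antisymm hz2 (sq_nonneg _))
end

section
/- The function u₀(t) = (2 + cos t)³ is positive, twice differentiable on ℝ, and satisfies u₀''(t) = (6.6 − 5.7·cos t − 9·cos² t)·u₀(t)^{1/3} − 0.3·u₀(t)^{2/3} for all t ∈ ℝ, together with the periodicity conditions u₀(0) = u₀(2π) and u₀'(0) = u₀'(2π). -/
open Real

/-- The function `u₀ t = (2 + cos t)³` is positive, twice differentiable on `ℝ`, solves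
the Liebau pumping equation `u'' = (6.6 − 5.7cos t − 9cos²t)u^(1/3) − 0.3u^(2/3)` and
satisfies the periodicity conditions `u₀ 0 = u₀ (2π)`, `u₀' 0 = u₀' (2π)`. -/
theorem stmt3 :
    (∀ t : ℝ, 0 < (2 + Real.cos t)^3) ∧
    ∃ u₀' u₀'' : ℝ → ℝ,
      (∀ t : ℝ, HasDerivAt (fun s : ℝ => (2 + Real.cos s)^3) (u₀' t) t) ∧
      (∀ t : ℝ, HasDerivAt u₀' (u₀'' t) t) ∧
      (∀ t : ℝ, u₀'' t
        = (6.6 - 5.7 * Real.cos t - 9 * (Real.cos t)^2) * ((2 + Real.cos t)^3) ^ ((1:ℝ)/3)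
          - 0.3 * ((2 + Real.cos t)^3) ^ ((2:ℝ)/3)) ∧
      (2 + Real.cos 0)^3 = (2 + Real.cos (2*Real.pi))^3 ∧
      u₀' 0 = u₀' (2*Real.pi) := by
  have pos (t : ℝ) : 0 < 2 + Real.cos t := by linarith [Real.neg_one_le_cos t]
  have hcos (t : ℝ) : HasDerivAt (fun s : ℝ => 2 + Real.cos s) (-Real.sin t) t :=
    (Real.hasDerivAt_cos t).const_add 2
  refine ⟨fun t => pow_pos (pos t) 3,
    fun t => -3 * (2 + Real.cos t)^2 * Real.sin t,
    fun t => (2 + Real.cos t) * (6 * Real.sin t ^ 2 - 3 * (2 + Real.cos t) * Real.cos t),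
    fun t => ?_, fun t => ?_, fun t => ?_, by simp, by simp⟩
  · refine ((hcos t).fun_pow 3).congr_deriv ?_
    push_cast
    ring
  · refine ((((hcos t).fun_pow 2).const_mul (-3)).fun_mul (Real.hasDerivAt_sin t)).congr_deriv ?_
    push_cast
    ring
  · have root : ((2 + Real.cos t)^3) ^ ((1:ℝ)/3) = 2 + Real.cos t := by
      rw [← Real.rpow_natCast_mul (pos t).le]
      norm_num
    have root_sq : ((2 + Real.cos t)^3) ^ ((2:ℝ)/3) = (2 + Real.cos t)^2 := by
      rw [← Real.rpow_natCast_mul (pos t).le, ← Real.rpow_natCast]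
      norm_num
    rw [root, root_sq]
    simp only [Real.sin_sq]
    ring
end

section
/- Let X be a real Banach space, Λ ⊂ ℝ open, x₀ ∈ X, ρ > 0, and let Φ : Λ × B(x₀,ρ) → X be continuous with a continuous partial Fréchet derivative (λ,x) ↦ Φ'ₓ(λ,x) ∈ L(X) on Λ × B(x₀,ρ), and with Φ(λ,x₀) = x₀ for every λ ∈ Λ. Let λ₀ ∈ Λ and assume the bounded linear operator K = Φ'ₓ(λ₀,x₀) is a compact operator on X. If (x₀,λ₀) is a bifurcation point of the solution set S = {(x,λ) ∈ B(x₀,ρ) × Λ : x = Φ(λ,x)}, then: (i) there exists q ∈ X such that the equation z − K z = q has no solution z ∈ X, and (ii) the homogeneous equation z − K z = 0 has at least one nontrivial solution z ∈ X. -/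
/-- `(x̄, λ̄)` is a bifurcation point of the solution set `S` if every neighborhood of
`(x̄, λ̄)` contains a pair `(y, μ) ∈ S` with `y ≠ x̄`. -/
def IsBifurcationPoint {X : Type*} [NormedAddCommGroup X] [NormedSpace ℝ X]
    (S : Set (X × ℝ)) (p : X × ℝ) : Prop :=
  ∀ U ∈ nhds p, ∃ q ∈ S, q ∈ U ∧ q.1 ≠ p.1

/-- If `T` is a compact operator on a normed space and `1 - T` is surjective, then `1 - T` is
injective. -/
theorem IsCompactOperator.injective_one_sub_of_surjective {𝕜 X : Type*}
    [NontriviallyNormedField 𝕜] [NormedAddCommGroup X] [NormedSpace 𝕜 X] {T : X →L[𝕜] X}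
    (hT : IsCompactOperator T) (hsurj : Function.Surjective (1 - T : X →L[𝕜] X)) :
    Function.Injective (1 - T : X →L[𝕜] X) := by
  set S : X →L[𝕜] X := 1 - T with hS
  rw [injective_iff_map_eq_zero]
  by_contra! h
  obtain ⟨x, hx, hx0⟩ := h
  have hSsucc (n : ℕ) (y : X) : (S ^ (n + 1)) y = (S ^ n) (S y) := by
    rw [pow_succ]; rfl
  have hSsucc' (n : ℕ) (y : X) : (S ^ (n + 1)) y = S ((S ^ n) y) := by
    rw [pow_succ']; rfl
  have hmono {m n : ℕ} (hmn : m ≤ n) {y : X} (hy : (S ^ m) y = 0) : (S ^ n) y = 0 := by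
    induction n, hmn using Nat.le_induction with
    | base => exact hy
    | succ n _ ih => rw [hSsucc', ih, map_zero]
  have hcomm (n : ℕ) (y : X) : (S ^ n) (S y) = S ((S ^ n) y) := by
    rw [← hSsucc, hSsucc']
  have hTS (y : X) : T y = y - S y := by simp [hS]
  have hpre (n : ℕ) : ∃ y, (S ^ n) y = x := by
    induction n with
    | zero => exact ⟨x, by simp⟩
    | succ n ih =>
      obtain ⟨y, hy⟩ := ih
      obtain ⟨z, rfl⟩ := hsurj y
      exact ⟨z, by rw [hSsucc, hy]⟩
  obtain ⟨c, hc⟩ := NormedField.exists_one_lt_norm 𝕜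
  have hriesz (n : ℕ) : ∃ y, (S ^ (n + 1)) y = 0 ∧ ‖y‖ ≤ ‖c‖ + 1 ∧
      ∀ z, (S ^ n) z = 0 → 1 ≤ ‖y - z‖ := by
    let V : Submodule 𝕜 X := (S ^ (n + 1)).ker
    let W : Submodule 𝕜 V := ((S ^ n).comp V.subtypeL).ker
    have hW : IsClosed (W : Set V) := ContinuousLinearMap.isClosed_ker _
    obtain ⟨y, hy⟩ := hpre n
    have hyV : (S ^ (n + 1)) y = 0 := by rw [hSsucc', hy, hx]
    have hne : ∃ v : V, v ∉ W := by
      refine ⟨⟨y, hyV⟩, fun hmem => hx0 ?_⟩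
      rw [← hy]
      exact hmem
    obtain ⟨v, hvn, hvW⟩ := riesz_lemma_of_norm_lt hc (lt_add_one ‖c‖) hW hne
    exact ⟨v, v.2, hvn, fun z hz => hvW ⟨z, hmono n.le_succ hz⟩ hz⟩
  choose f hker hnorm hfar using hriesz
  have hsep {m n : ℕ} (hmn : m < n) : 1 ≤ ‖T (f n) - T (f m)‖ := by
    have hz : (S ^ n) (S (f n) + T (f m)) = 0 := by
      have hm : (S ^ n) (f m) = 0 := hmono hmn (hker m)
      rw [map_add, ← hSsucc, hker, hTS, map_sub, hcomm, hm, map_zero, sub_zero, add_zero]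
    have := hfar n _ hz
    rwa [← sub_sub, ← hTS] at this
  obtain ⟨C, hC, hTC⟩ := hT.image_closedBall_subset_compact (‖c‖ + 1)
  obtain ⟨y, -, ψ, hψ, hlim⟩ :=
    hC.tendsto_subseq (x := fun n => T (f n)) (fun n => hTC ⟨f n, by simp [hnorm], rfl⟩)
  obtain ⟨N, hN⟩ := Metric.cauchySeq_iff'.1 hlim.cauchySeq 1 one_pos
  have hlt := hN (N + 1) N.le_succ
  rw [dist_eq_norm] at hlt
  exact hlt.not_ge (hsep (hψ N.lt_succ_self))

/-- If `Id - Φ'ₓ(λ₀, x₀)` is bounded below, then `(x₀, λ₀)` is not a bifurcation point of the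
fixed point set of `Φ`. -/
theorem not_isBifurcationPoint_of_bounded_below {X : Type*} [NormedAddCommGroup X]
    [NormedSpace ℝ X] {Λ : Set ℝ} {x₀ : X} {ρ : ℝ}
    {Φ : ℝ → X → X} {D : ℝ → X → X →L[ℝ] X}
    (hderiv : ∀ lam ∈ Λ, ∀ x ∈ Metric.closedBall x₀ ρ,
      HasFDerivWithinAt (Φ lam) (D lam x) (Metric.closedBall x₀ ρ) x)
    {lam₀ : ℝ}
    (hdcont : ContinuousWithinAt (fun p : ℝ × X => D p.1 p.2) (Λ ×ˢ Metric.closedBall x₀ ρ)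
      (lam₀, x₀))
    (htriv : ∀ lam ∈ Λ, Φ lam x₀ = x₀) {c : ℝ} (hc : 0 < c)
    (hbelow : ∀ z, c * ‖z‖ ≤ ‖z - D lam₀ x₀ z‖) :
    ¬ IsBifurcationPoint
      {p : X × ℝ | p.1 ∈ Metric.closedBall x₀ ρ ∧ p.2 ∈ Λ ∧ p.1 = Φ p.2 p.1} (x₀, lam₀) := by
  intro hbif
  obtain ⟨δ, hδ, hD⟩ := Metric.continuousWithinAt_iff.1 hdcont (c / 2) (half_pos hc)
  obtain ⟨⟨y, μ⟩, ⟨hyρ, hμ, hfix⟩, hnear, hne⟩ := hbif _ (Metric.ball_mem_nhds _ hδ)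
  simp only at hyρ hμ hfix hne
  rw [Metric.mem_ball, Prod.dist_eq, max_lt_iff] at hnear
  obtain ⟨hyδ, hμδ⟩ := hnear
  have hsub : Metric.closedBall x₀ (dist y x₀) ⊆ Metric.closedBall x₀ ρ :=
    Metric.closedBall_subset_closedBall hyρ
  have hmvt := (convex_closedBall x₀ (dist y x₀)).norm_image_sub_le_of_norm_hasFDerivWithin_le'
    (φ := D lam₀ x₀) (C := c / 2)
    (fun x hx => (hderiv μ hμ x (hsub hx)).mono hsub)
    (fun x hx => by
      rw [← dist_eq_norm]
      refine (hD (x := (μ, x)) ⟨hμ, hsub hx⟩ ?_).le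
      rw [Prod.dist_eq, max_lt_iff]
      exact ⟨hμδ, (Metric.mem_closedBall.1 hx).trans_lt hyδ⟩)
    (Metric.mem_closedBall_self dist_nonneg) (Metric.mem_closedBall.2 le_rfl)
  rw [← hfix, htriv μ hμ] at hmvt
  have hpos : 0 < ‖y - x₀‖ := norm_pos_iff.2 (sub_ne_zero.2 hne)
  nlinarith [hbelow (y - x₀)]

/-- Abstract form of Theorem 3.12 (necessary condition for bifurcation): if `x₀` is a
trivial branch of fixed points of `Φ`, `Φ` and `Φ'ₓ` are continuous, the operator
`K = Φ'ₓ(λ₀, x₀)` is compact, and `(x₀, λ₀)` is a bifurcation point, then there is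
`q ∈ X` such that `z − Kz = q` has no solution, and `z − Kz = 0` has a nontrivial
solution. -/
theorem stmt8 {X : Type*} [NormedAddCommGroup X] [NormedSpace ℝ X] [CompleteSpace X]
    (Λ : Set ℝ) (hΛ : IsOpen Λ) (x₀ : X) (ρ : ℝ) (hρ : 0 < ρ)
    (Φ : ℝ → X → X) (D : ℝ → X → X →L[ℝ] X)
    (hcont : ContinuousOn (fun p : ℝ × X => Φ p.1 p.2) (Λ ×ˢ Metric.closedBall x₀ ρ))
    (hderiv : ∀ lam ∈ Λ, ∀ x ∈ Metric.closedBall x₀ ρ,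
      HasFDerivWithinAt (Φ lam) (D lam x) (Metric.closedBall x₀ ρ) x)
    (hdcont : ContinuousOn (fun p : ℝ × X => D p.1 p.2) (Λ ×ˢ Metric.closedBall x₀ ρ))
    (htriv : ∀ lam ∈ Λ, Φ lam x₀ = x₀)
    (lam₀ : ℝ) (hlam₀ : lam₀ ∈ Λ)
    (hcompact : IsCompactOperator (D lam₀ x₀))
    (hbif : IsBifurcationPoint
      {p : X × ℝ | p.1 ∈ Metric.closedBall x₀ ρ ∧ p.2 ∈ Λ ∧ p.1 = Φ p.2 p.1}
      (x₀, lam₀)) :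
    (∃ q : X, ∀ z : X, z - D lam₀ x₀ z ≠ q) ∧
    (∃ z : X, z ≠ 0 ∧ z - D lam₀ x₀ z = 0) := by
  have hker : ∃ z : X, z ≠ 0 ∧ z - D lam₀ x₀ z = 0 := by
    by_contra! hinj
    have hnot : ¬ Module.End.HasEigenvalue (D lam₀ x₀ : Module.End ℝ X) 1 := by
      intro h
      obtain ⟨v, hv⟩ := h.exists_hasEigenvector
      refine hinj v hv.2 ?_
      have := hv.apply_eq_smul
      rw [one_smul] at this
      exact sub_eq_zero.2 this.symm
    obtain ⟨K, hK⟩ := hcompact.antilipschitz_of_not_hasEigenvalue one_ne_zero hnot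
    obtain ⟨c, hc, hbelow⟩ := antilipschitzWith_iff_exists_mul_le_norm.1 ⟨K, hK⟩
    refine not_isBifurcationPoint_of_bounded_below hderiv
      (hdcont _ ⟨hlam₀, Metric.mem_closedBall_self hρ.le⟩) htriv hc (fun z => ?_) hbif
    rw [norm_sub_rev]
    simpa using hbelow z
  refine ⟨?_, hker⟩
  by_contra! hsurj
  obtain ⟨z, hz, hz0⟩ := hker
  have hinj := hcompact.injective_one_sub_of_surjective
    (fun q => (hsurj q).imp fun _ h => by simpa using h)
  exact hz (hinj (by simpa using hz0))
end

section
/- Let T > 0, n ∈ ℕ, and let w : [0,T] → ℝⁿ have bounded variation on [0,T], be left-continuous at every point of (0,T], and be right-continuous at 0. Suppose that for every infinitely differentiable function φ : ℝ → ℝ whose support is a compact subset of the open interval (0,T) one has ∫₀ᵀ w(t)·φ'(t) dt = 0 (componentwise, as a Lebesgue integral). Then w is constant on [0,T]. -/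
open MeasureTheory Set

/-- A smooth function compactly supported in `(a, b)` with zero integral has a smooth
antiderivative compactly supported in `(a, b)`. -/
theorem exists_contDiff_compactSupport_deriv_eq {a b : ℝ} (hab : a < b) {h : ℝ → ℝ}
    (hsm : ContDiff ℝ (⊤ : ℕ∞) h) (hc : HasCompactSupport h) (hsub : tsupport h ⊆ Ioo a b)
    (hint : ∫ x in a..b, h x = 0) :
    ∃ ψ : ℝ → ℝ, ContDiff ℝ (⊤ : ℕ∞) ψ ∧ HasCompactSupport ψ ∧ tsupport ψ ⊆ Ioo a b ∧
      deriv ψ = h := by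
  obtain ⟨m, hm⟩ := nonempty_Ioo.2 hab
  have hK : IsCompact (insert m (tsupport h)) := hc.isCompact.insert m
  have hKne : (insert m (tsupport h)).Nonempty := insert_nonempty _ _
  have hKsub : insert m (tsupport h) ⊆ Ioo a b := insert_subset hm hsub
  obtain ⟨c, hcK, hcle⟩ := hK.exists_isLeast hKne
  obtain ⟨d, hdK, hdge⟩ := hK.exists_isGreatest hKne
  have hac := (hKsub hcK).1
  have hdb := (hKsub hdK).2
  have hlow : ∀ x < c, h x = 0 := fun x hx ↦ by
    by_contra hne
    exact hx.not_ge (hcle (mem_insert_of_mem _ (subset_tsupport h hne)))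
  have hhigh : ∀ x, d < x → h x = 0 := fun x hx ↦ by
    by_contra hne
    exact hx.not_ge (hdge (mem_insert_of_mem _ (subset_tsupport h hne)))
  have hderiv : ∀ x, HasDerivAt (fun x ↦ ∫ t in a..x, h t) (h x) x := fun x ↦
    hsm.continuous.integral_hasStrictDerivAt a x |>.hasDerivAt
  have hderiv_eq : deriv (fun x ↦ ∫ t in a..x, h t) = h := funext fun x ↦ (hderiv x).deriv
  have hzero : ∀ x ∉ Icc c d, ∫ t in a..x, h t = 0 := fun x hx ↦ by
    rcases lt_or_ge x c with hxc | hxc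
    · refine intervalIntegral.integral_zero_ae (.of_forall fun t ht ↦ hlow t ?_)
      exact (uIoc_subset_uIcc ht).2.trans_lt (max_lt hac hxc)
    · have hdx : d < x := not_le.1 fun hxd ↦ hx ⟨hxc, hxd⟩
      rw [← intervalIntegral.integral_add_adjacent_intervals
        (hsm.continuous.intervalIntegrable a b) (hsm.continuous.intervalIntegrable b x), hint,
        zero_add]
      refine intervalIntegral.integral_zero_ae (.of_forall fun t ht ↦ hhigh t ?_)
      exact (lt_min hdb hdx).trans_le (uIoc_subset_uIcc ht).1
  refine ⟨fun x ↦ ∫ t in a..x, h t, ?_, HasCompactSupport.intro isCompact_Icc hzero, ?_,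
    hderiv_eq⟩
  · exact contDiff_infty_iff_deriv.2 ⟨fun x ↦ (hderiv x).differentiableAt, by rwa [hderiv_eq]⟩
  · refine (closure_minimal (fun x hx ↦ ?_) isClosed_Icc).trans (Icc_subset_Ioo hac hdb)
    by_contra hx'
    exact hx (hzero x hx')

/-- The integral over `(a, b)` of a function multiplied by one supported in `(a, b)` is the integral
over the whole line. -/
theorem intervalIntegral_smul_eq_integral_of_tsupport_subset {G : Type*} [NormedAddCommGroup G]
    [NormedSpace ℝ G] {a b : ℝ} (hab : a ≤ b) {g : ℝ → ℝ} (f : ℝ → G)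
    (hg : tsupport g ⊆ Ioo a b) : ∫ x in a..b, g x • f x = ∫ x, g x • f x := by
  rw [intervalIntegral.integral_of_le hab]
  refine setIntegral_eq_integral_of_forall_compl_eq_zero fun x hx ↦ ?_
  rw [image_eq_zero_of_notMem_tsupport fun hx' ↦ hx (Ioo_subset_Ioc_self (hg hx')), zero_smul]

/-- **Du Bois-Reymond lemma**: an integrable function whose distributional derivative vanishes on
an interval is almost everywhere constant there. -/
theorem ae_eq_const_of_forall_integral_deriv_smul_eq_zero {F : Type*} [NormedAddCommGroup F]
    [NormedSpace ℝ F] [CompleteSpace F] {a b : ℝ} (hab : a < b) {w : ℝ → F}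
    (hw : IntervalIntegrable w volume a b)
    (h : ∀ φ : ℝ → ℝ, ContDiff ℝ (⊤ : ℕ∞) φ → HasCompactSupport φ →
      tsupport φ ⊆ Ioo a b → (∫ t in a..b, deriv φ t • w t) = 0) :
    ∃ c : F, ∀ᵐ x, x ∈ Ioo a b → w x = c := by
  let χ : ContDiffBump ((a + b) / 2) :=
    ⟨(b - a) / 8, (b - a) / 4, by linarith, by linarith⟩
  set η : ℝ → ℝ := χ.normed volume with hη
  have hηsm : ContDiff ℝ (⊤ : ℕ∞) η := χ.contDiff_normed
  have hηc : HasCompactSupport η := χ.hasCompactSupport_normed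
  have hηsub : tsupport η ⊆ Ioo a b := by
    rw [hη, χ.tsupport_normed_eq, Real.closedBall_eq_Icc]
    apply Icc_subset_Ioo <;> simp only [χ] <;> linarith
  have hηint : ∫ x in a..b, η x = 1 := by
    have := intervalIntegral_smul_eq_integral_of_tsupport_subset hab.le (fun _ ↦ (1 : ℝ)) hηsub
    simp only [smul_eq_mul, mul_one] at this
    rw [this, χ.integral_normed]
  have hmul : ∀ g : ℝ → ℝ, Continuous g → IntervalIntegrable (fun t ↦ g t • w t) volume a b :=
    fun g hg ↦ hw.continuousOn_smul hg.continuousOn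
  set c : F := ∫ t in a..b, η t • w t with hcdef
  refine ⟨c, ?_⟩
  have hloc : LocallyIntegrableOn (fun x ↦ w x - c) (Ioo a b) volume := by
    refine IntegrableOn.locallyIntegrableOn ?_
    exact (((intervalIntegrable_iff_integrableOn_Ioc_of_le hab.le).1
      (hw.sub intervalIntegrable_const)).mono_set Ioo_subset_Ioc_self)
  have key := isOpen_Ioo.ae_eq_zero_of_integral_contDiff_smul_eq_zero hloc fun g hg hgc hgs ↦ ?_
  · filter_upwards [key] with x hx hxI using sub_eq_zero.1 (hx hxI)
  set I : ℝ := ∫ x in a..b, g x with hI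
  have hgI : IntervalIntegrable g volume a b := hg.continuous.intervalIntegrable a b
  have hηI : IntervalIntegrable η volume a b := hηsm.continuous.intervalIntegrable a b
  have hsub' : tsupport (fun x ↦ g x - I * η x) ⊆ tsupport g ∪ tsupport η := by
    refine closure_minimal (fun x hx ↦ ?_) ((isClosed_tsupport g).union (isClosed_tsupport η))
    by_contra hx'
    rw [mem_union, not_or] at hx'
    refine hx ?_
    simp [image_eq_zero_of_notMem_tsupport hx'.1, image_eq_zero_of_notMem_tsupport hx'.2]
  obtain ⟨ψ, hψ, hψc, hψs, hψd⟩ := exists_contDiff_compactSupport_deriv_eq hab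
    (h := fun x ↦ g x - I * η x) (hg.sub (contDiff_const.mul hηsm))
    ((hgc.isCompact.union hηc.isCompact).of_isClosed_subset (isClosed_tsupport _) hsub')
    (hsub'.trans (union_subset hgs hηsub))
    (by rw [intervalIntegral.integral_sub hgI (hηI.const_mul I),
          intervalIntegral.integral_const_mul, hηint, mul_one, sub_self])
  have h0 := h ψ hψ hψc hψs
  simp only [hψd, sub_smul, mul_smul] at h0
  have hηw : IntervalIntegrable (fun t ↦ I • η t • w t) volume a b :=
    (hmul η hηsm.continuous).smul I
  rw [intervalIntegral.integral_sub (hmul g hg.continuous) hηw,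
    intervalIntegral.integral_smul, ← hcdef] at h0
  rw [← intervalIntegral_smul_eq_integral_of_tsupport_subset hab.le _ hgs]
  simp only [smul_sub]
  have hgc_int : IntervalIntegrable (fun t ↦ g t • c) volume a b :=
    (hg.continuous.smul continuous_const).intervalIntegrable a b
  rw [intervalIntegral.integral_sub (hmul g hg.continuous) hgc_int,
    intervalIntegral.integral_smul_const, ← hI, h0]

/-- A function of bounded variation on a compact interval is integrable there. -/
theorem BoundedVariationOn.integrableOn_Icc {n : ℕ} {w : ℝ → EuclideanSpace ℝ (Fin n)} {a b : ℝ}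
    (hw : BoundedVariationOn w (Icc a b)) : IntegrableOn w (Icc a b) := by
  refine Integrable.of_eval_piLp fun i ↦ ?_
  have hi : BoundedVariationOn (fun t ↦ w t i) (Icc a b) :=
    (EuclideanSpace.proj (𝕜 := ℝ) i).lipschitz.comp_boundedVariationOn hw
  obtain ⟨p, q, hp, hq, hpq⟩ := hi.locallyBoundedVariationOn.exists_monotoneOn_sub_monotoneOn
  rw [hpq]
  exact (hp.integrableOn_isCompact isCompact_Icc).sub (hq.integrableOn_isCompact isCompact_Icc)

/-- A property holding almost everywhere on an interval holds somewhere on every nonempty open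
subinterval. -/
theorem exists_mem_Ioo_of_ae_mem_Ioo {p : ℝ → Prop} {a b l u : ℝ}
    (h : ∀ᵐ x, x ∈ Ioo a b → p x) (hlu : l < u) (hal : a ≤ l) (hub : u ≤ b) :
    ∃ x ∈ Ioo l u, p x := by
  by_contra! hne
  have hnull : volume (Ioo l u) = 0 :=
    measure_mono_null (fun x hx (hx' : x ∈ Ioo a b → p x) ↦
      hne x hx (hx' (Ioo_subset_Ioo hal hub hx))) (ae_iff.1 h)
  rw [Real.volume_Ioo, ENNReal.ofReal_eq_zero] at hnull
  linarith

/-- A function `w : [0,T] → ℝⁿ` of bounded variation, left-continuous on `(0,T]` and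
right-continuous at `0`, whose distributional derivative vanishes on `(0,T)` (i.e.
`∫₀ᵀ φ'(t) • w(t) dt = 0` for every smooth `φ` compactly supported in `(0,T)`), is
constant on `[0,T]`. -/
theorem stmt11 (T : ℝ) (hT : 0 < T) (n : ℕ) (w : ℝ → EuclideanSpace ℝ (Fin n))
    (hbv : BoundedVariationOn w (Set.Icc 0 T))
    (hlc : ∀ t ∈ Set.Ioc (0:ℝ) T, Filter.Tendsto w (nhdsWithin t (Set.Iio t)) (nhds (w t)))
    (hrc : Filter.Tendsto w (nhdsWithin 0 (Set.Ioi 0)) (nhds (w 0)))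
    (hdistr : ∀ φ : ℝ → ℝ, ContDiff ℝ (⊤ : ℕ∞) φ → HasCompactSupport φ →
      tsupport φ ⊆ Set.Ioo 0 T → (∫ t in (0:ℝ)..T, deriv φ t • w t) = 0) :
    ∀ t ∈ Set.Icc (0:ℝ) T, w t = w 0 := by
  have hint : IntervalIntegrable w volume 0 T :=
    (intervalIntegrable_iff_integrableOn_Icc_of_le hT.le).2 hbv.integrableOn_Icc
  obtain ⟨c, hc⟩ := ae_eq_const_of_forall_integral_deriv_smul_eq_zero hT hint hdistr
  have h0 : w 0 = c := by
    refine isClosed_singleton.mem_of_frequently_of_tendsto (s := {c}) (fun hev ↦ ?_) hrc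
    obtain ⟨u, hu, hsub⟩ := mem_nhdsGT_iff_exists_Ioo_subset.1 hev
    obtain ⟨x, hx, hxc⟩ := exists_mem_Ioo_of_ae_mem_Ioo hc (lt_min hu hT) le_rfl
      (min_le_right u T)
    exact hsub ⟨hx.1, hx.2.trans_le (min_le_left _ _)⟩ hxc
  intro t ht
  rcases ht.1.eq_or_lt with rfl | ht0
  · rfl
  rw [h0]
  refine isClosed_singleton.mem_of_frequently_of_tendsto (s := {c}) (fun hev ↦ ?_)
    (hlc t ⟨ht0, ht.2⟩)
  obtain ⟨l, hl, hsub⟩ := mem_nhdsLT_iff_exists_Ioo_subset.1 hev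
  obtain ⟨x, hx, hxc⟩ := exists_mem_Ioo_of_ae_mem_Ioo hc (max_lt hl ht0) (le_max_right l 0) ht.2
  exact hsub ⟨(le_max_left _ _).trans_lt hx.1, hx.2⟩ hxc
end
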